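/- Let Y be a complete sub-σ-field of a probability space (Ω, M, P) and let (X_n)_{n ∈ ℕ} be a nonincreasing sequence of complete sub-σ-fields of M such that Y and X_1 are conditionally independent given X_n for every n ∈ ℕ. Then ⋀_{n ∈ ℕ} (X_n ∨ Y) = (⋀_{n ∈ ℕ} X_n) ∨ Y. -/

import Mathlib

open MeasureTheory ProbabilityTheory

/-- The σ-field `0_Λ` of `P`-trivial events: events of the ambient σ-field `m` whose
probability is `0` or `1`. -/
def zeroLambda {Ω : Type*} (m : MeasurableSpace Ω) (P : @MeasureTheory.Measure Ω m) :
    MeasurableSpace Ω :=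
  MeasurableSpace.generateFrom {A : Set Ω | MeasurableSet[m] A ∧ (P A = 0 ∨ P A = 1)}

/-- The conditional probability `P[A | W]` of an event `A` given a σ-field `W`,
as a random variable (conditional expectation of the indicator). -/
noncomputable def condProb {Ω : Type*} {m : MeasurableSpace Ω} (P : Measure Ω)
    (W : MeasurableSpace Ω) (A : Set Ω) : Ω → ℝ :=
  P[A.indicator (fun _ => (1 : ℝ)) | W]
/-- Two σ-fields `A`, `B` are conditionally independent given `W` if
`P[A₀ ∩ B₀ | W] = P[A₀ | W] · P[B₀ | W]` a.s. for all `A₀ ∈ A`, `B₀ ∈ B`. -/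
def CondIndepPair {Ω : Type*} {m : MeasurableSpace Ω} (P : Measure Ω)
    (W A B : MeasurableSpace Ω) : Prop :=
  ∀ A₀ B₀ : Set Ω, MeasurableSet[A] A₀ → MeasurableSet[B] B₀ →
    condProb P W (A₀ ∩ B₀) =ᵐ[P] fun ω => condProb P W A₀ ω * condProb P W B₀ ω

section

variable {Ω : Type*} {m : MeasurableSpace Ω} {P : Measure Ω}

lemma measurableSet_of_ae_eq_of_zeroLambda_le {W : MeasurableSpace Ω} (hWm : W ≤ m)
    (hW : zeroLambda m P ≤ W) {s t : Set Ω} (hs : MeasurableSet[m] s) (ht : MeasurableSet[W] t)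
    (hst : s =ᵐ[P] t) : MeasurableSet[W] s := by
  have hnull : ∀ u : Set Ω, MeasurableSet[m] u → P u = 0 → MeasurableSet[W] u := fun u hu h0 =>
    hW _ (MeasurableSpace.measurableSet_generateFrom ⟨hu, Or.inl h0⟩)
  have h1 := hnull (s \ t) (hs.diff (hWm _ ht)) (ae_le_set.1 hst.le)
  have h2 := hnull (t \ s) ((hWm _ ht).diff hs) (ae_le_set.1 hst.symm.le)
  have : s = (t \ (t \ s)) ∪ (s \ t) := by ext x; simp; tauto
  rw [this]
  exact (ht.diff h2).union h1

lemma setIntegral_eq_of_isPiSystem {f g : Ω → ℝ} (hf : Integrable f P) (hg : Integrable g P)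
    {W : MeasurableSpace Ω} (hWm : W ≤ m) {π : Set (Set Ω)}
    (hW : W = MeasurableSpace.generateFrom π) (hπ : IsPiSystem π)
    (huniv : ∫ ω, f ω ∂P = ∫ ω, g ω ∂P)
    (h : ∀ s ∈ π, ∫ ω in s, f ω ∂P = ∫ ω in s, g ω ∂P) {s : Set Ω} (hs : MeasurableSet[W] s) :
    ∫ ω in s, f ω ∂P = ∫ ω in s, g ω ∂P := by
  induction s, hs using MeasurableSpace.induction_on_inter hW hπ with
  | empty => simp
  | basic s hs => exact h s hs
  | compl s hs ih =>
    rw [setIntegral_compl (hWm _ hs) hf, setIntegral_compl (hWm _ hs) hg, ih, huniv]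
  | iUnion s hd hs ih =>
    rw [integral_iUnion (fun i => hWm _ (hs i)) hd hf.integrableOn,
      integral_iUnion (fun i => hWm _ (hs i)) hd hg.integrableOn]
    exact tsum_congr ih

lemma isPiSystem_inter_measurableSet (U V : MeasurableSpace Ω) :
    IsPiSystem {s : Set Ω | ∃ a b, MeasurableSet[U] a ∧ MeasurableSet[V] b ∧ s = a ∩ b} := by
  rintro _ ⟨a, b, ha, hb, rfl⟩ _ ⟨a', b', ha', hb', rfl⟩ -
  exact ⟨a ∩ a', b ∩ b', ha.inter ha', hb.inter hb', Set.inter_inter_inter_comm ..⟩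

lemma sup_eq_generateFrom_inter (U V : MeasurableSpace Ω) :
    U ⊔ V = MeasurableSpace.generateFrom
      {s : Set Ω | ∃ a b, MeasurableSet[U] a ∧ MeasurableSet[V] b ∧ s = a ∩ b} := by
  apply le_antisymm
  · refine sup_le (fun a ha => ?_) (fun b hb => ?_)
    · exact MeasurableSpace.measurableSet_generateFrom ⟨a, Set.univ, ha, .univ, by simp⟩
    · exact MeasurableSpace.measurableSet_generateFrom ⟨Set.univ, b, .univ, hb, by simp⟩
  · refine MeasurableSpace.generateFrom_le ?_
    rintro _ ⟨a, b, ha, hb, rfl⟩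
    exact ((le_sup_left : U ≤ U ⊔ V) _ ha).inter ((le_sup_right : V ≤ U ⊔ V) _ hb)

lemma setIntegral_sup_eq {f g : Ω → ℝ} (hf : Integrable f P) (hg : Integrable g P)
    {U V : MeasurableSpace Ω} (hU : U ≤ m) (hV : V ≤ m)
    (h : ∀ a b, MeasurableSet[U] a → MeasurableSet[V] b →
      ∫ ω in a ∩ b, f ω ∂P = ∫ ω in a ∩ b, g ω ∂P) {s : Set Ω} (hs : MeasurableSet[U ⊔ V] s) :
    ∫ ω in s, f ω ∂P = ∫ ω in s, g ω ∂P := by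
  refine setIntegral_eq_of_isPiSystem hf hg (sup_le hU hV) (sup_eq_generateFrom_inter U V)
    (isPiSystem_inter_measurableSet U V) ?_ ?_ hs
  · simpa using h Set.univ Set.univ .univ .univ
  · rintro _ ⟨a, b, ha, hb, rfl⟩
    exact h a b ha hb

lemma measurable_iInf_of_forall_ae_eq {ι : Type*} [Nonempty ι] {X : ι → MeasurableSpace Ω}
    (hXm : ∀ n, X n ≤ m) (hXc : ∀ n, zeroLambda m P ≤ X n) {f : Ω → ℝ} (hf : Measurable[m] f)
    (h : ∀ n, ∃ g : Ω → ℝ, Measurable[X n] g ∧ f =ᵐ[P] g) : Measurable[⨅ n, X n] f := by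
  intro s hs
  rw [MeasurableSpace.measurableSet_iInf]
  intro n
  obtain ⟨g, hg, hfg⟩ := h n
  refine measurableSet_of_ae_eq_of_zeroLambda_le (hXm n) (hXc n) (hf hs) (hg hs) ?_
  filter_upwards [hfg] with ω hω
  apply propext
  change f ω ∈ s ↔ g ω ∈ s
  rw [hω]

variable [IsProbabilityMeasure P]

lemma integrable_indicator_one {s : Set Ω} (hs : MeasurableSet[m] s) :
    Integrable (s.indicator (fun _ => (1 : ℝ))) P :=
  (integrable_const 1).indicator hs

lemma CondIndepPair.condProb_sup_ae_eq {W Y Z : MeasurableSpace Ω} (hW : W ≤ m) (hY : Y ≤ m)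
    (hZ : Z ≤ m) (h : CondIndepPair P W Y Z) {A : Set Ω} (hA : MeasurableSet[Z] A) :
    condProb P (W ⊔ Y) A =ᵐ[P] condProb P W A := by
  have hWY : W ⊔ Y ≤ m := sup_le hW hY
  have hAi := integrable_indicator_one (P := P) (hZ _ hA)
  have hsm : StronglyMeasurable[W] (condProb P W A) := stronglyMeasurable_condExp
  refine (ae_eq_condExp_of_forall_setIntegral_eq hWY hAi
    (fun s _ _ => integrable_condExp.integrableOn) (fun s hs _ => ?_)
    (hsm.mono (le_sup_left : W ≤ W ⊔ Y)).aestronglyMeasurable).symm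
  refine setIntegral_sup_eq integrable_condExp hAi hW hY (fun a b ha hb => ?_) hs
  have hb' := hY _ hb
  have hbi := integrable_indicator_one (P := P) hb'
  have hprod : b.indicator (fun _ => (1 : ℝ)) * condProb P W A = b.indicator (condProb P W A) := by
    ext ω; by_cases hω : ω ∈ b <;> simp [hω]
  have hpull : P[b.indicator (condProb P W A) | W] =ᵐ[P] condProb P W (b ∩ A) := by
    have hmul : Integrable (b.indicator (condProb P W A)) P := integrable_condExp.indicator hb'
    rw [← hprod] at hmul ⊢
    exact (condExp_mul_of_stronglyMeasurable_right hsm hmul hbi).trans (h b A hb hA).symm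
  calc ∫ ω in a ∩ b, condProb P W A ω ∂P
      = ∫ ω in a, b.indicator (condProb P W A) ω ∂P := (setIntegral_indicator hb').symm
    _ = ∫ ω in a, (P[b.indicator (condProb P W A) | W]) ω ∂P :=
        (setIntegral_condExp hW (integrable_condExp.indicator hb') ha).symm
    _ = ∫ ω in a, condProb P W (b ∩ A) ω ∂P :=
        integral_congr_ae (ae_restrict_of_ae hpull)
    _ = ∫ ω in a, (b ∩ A).indicator (fun _ => (1 : ℝ)) ω ∂P :=
        setIntegral_condExp hW (integrable_indicator_one (hb'.inter (hZ _ hA))) ha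
    _ = ∫ ω in a ∩ b, A.indicator (fun _ => (1 : ℝ)) ω ∂P := by
        rw [← setIntegral_indicator hb', Set.indicator_indicator]

lemma CondIndepPair.condExp_ae_eq {W Y Z : MeasurableSpace Ω} (hY : Y ≤ m)
    (hZ : Z ≤ m) (hWZ : W ≤ Z) (h : CondIndepPair P W Y Z) {g : Ω → ℝ} (hg : Integrable g P)
    (hgm : StronglyMeasurable[W ⊔ Y] g) :
    P[g | Z] =ᵐ[P] P[g | W] := by
  have hW : W ≤ m := hWZ.trans hZ
  have hWY : W ⊔ Y ≤ m := sup_le hW hY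
  refine (ae_eq_condExp_of_forall_setIntegral_eq hZ hg
    (fun s _ _ => integrable_condExp.integrableOn) (fun A hA _ => ?_)
    (stronglyMeasurable_condExp.mono hWZ).aestronglyMeasurable).symm
  have hAm := hZ _ hA
  have hAi := integrable_indicator_one (P := P) hAm
  have hprod : ∀ f : Ω → ℝ, f * A.indicator (fun _ => (1 : ℝ)) = A.indicator f := by
    intro f; ext ω; by_cases hω : ω ∈ A <;> simp [hω]
  have h1 : P[g * A.indicator (fun _ => (1 : ℝ)) | W ⊔ Y] =ᵐ[P] g * condProb P W A := by
    refine (condExp_mul_of_stronglyMeasurable_left hgm ?_ hAi).trans ?_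
    · rw [hprod]; exact hg.indicator hAm
    · filter_upwards [h.condProb_sup_ae_eq hW hY hZ hA] with ω hω
      simp only [Pi.mul_apply]
      rw [← hω, condProb]
  have hmul : Integrable (g * condProb P W A) P := integrable_condExp.congr h1
  have h2 : P[g * condProb P W A | W] =ᵐ[P] P[g | W] * condProb P W A :=
    condExp_mul_of_stronglyMeasurable_right stronglyMeasurable_condExp hmul hg
  have h3 : P[P[g | W] * A.indicator (fun _ => (1 : ℝ)) | W] =ᵐ[P] P[g | W] * condProb P W A := by
    refine condExp_mul_of_stronglyMeasurable_left stronglyMeasurable_condExp ?_ hAi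
    rw [hprod]; exact integrable_condExp.indicator hAm
  rw [← integral_indicator hAm, ← integral_indicator hAm, ← hprod (P[g | W]), ← hprod g, ← integral_condExp hW,
    integral_congr_ae (h3.trans h2.symm), integral_condExp hW, ← integral_congr_ae h1,
    integral_condExp hWY]

/-- If a function is integrable and measurable with respect to every `X n ⊔ Y`, and its conditional
expectation given `⨅ n, X n` vanishes, so does its conditional expectation given `X 0`. -/
lemma condExp_ae_eq_zero_of_condIndepPair {Y : MeasurableSpace Ω} (hYm : Y ≤ m)
    {X : ℕ → MeasurableSpace Ω} (hXm : ∀ n, X n ≤ m) (hXc : ∀ n, zeroLambda m P ≤ X n)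
    (hanti : Antitone X) (hCI : ∀ n, CondIndepPair P (X n) Y (X 0)) {g : Ω → ℝ}
    (hg : Integrable g P) (hgm : ∀ n, StronglyMeasurable[X n ⊔ Y] g)
    (h0 : P[g | ⨅ n, X n] =ᵐ[P] 0) : P[g | X 0] =ᵐ[P] 0 := by
  have hle : ⨅ n, X n ≤ X 0 := iInf_le X 0
  have hmeas : Measurable[⨅ n, X n] (P[g | X 0]) :=
    measurable_iInf_of_forall_ae_eq hXm hXc
      (stronglyMeasurable_condExp.mono (hXm 0)).measurable fun n =>
        ⟨P[g | X n], stronglyMeasurable_condExp.measurable,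
          (hCI n).condExp_ae_eq hYm (hXm 0) (hanti n.zero_le) hg (hgm n)⟩
  have htower := condExp_condExp_of_le (μ := P) (f := g) hle (hXm 0)
  rw [condExp_of_stronglyMeasurable (hle.trans (hXm 0)) hmeas.stronglyMeasurable
    integrable_condExp] at htower
  exact htower.trans h0

end

/-- **Distributivity VI.** If `(X_n)` is nonincreasing and `Y`, `X_1` are conditionally
independent given `X_n` for every `n`, then `⋀_n (X_n ∨ Y) = (⋀_n X_n) ∨ Y`. -/
theorem stmt18 {Ω : Type*} {m : MeasurableSpace Ω} (P : Measure Ω) [IsProbabilityMeasure P]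
    (Y : MeasurableSpace Ω) (hYm : Y ≤ m) (hYc : zeroLambda m P ≤ Y)
    (X : ℕ → MeasurableSpace Ω) (hXm : ∀ n, X n ≤ m) (hXc : ∀ n, zeroLambda m P ≤ X n)
    (hanti : ∀ i j : ℕ, i ≤ j → X j ≤ X i)
    (hCI : ∀ n : ℕ, CondIndepPair P (X n) Y (X 0)) :
    ⨅ n : ℕ, (X n ⊔ Y) = (⨅ n : ℕ, X n) ⊔ Y := by
  refine le_antisymm ?_ (sup_le (le_iInf fun n => (iInf_le X n).trans le_sup_left)
    (le_iInf fun _ => le_sup_right))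
  intro D hD
  have hDn : ∀ n, MeasurableSet[X n ⊔ Y] D := MeasurableSpace.measurableSet_iInf.1 hD
  have hIm : ⨅ n, X n ≤ m := (iInf_le X 0).trans (hXm 0)
  have hVm : (⨅ n, X n) ⊔ Y ≤ m := sup_le hIm hYm
  have hVle : ∀ n, (⨅ n, X n) ⊔ Y ≤ X n ⊔ Y := fun n => sup_le_sup_right (iInf_le X n) Y
  have h0m : X 0 ⊔ Y ≤ m := sup_le (hXm 0) hYm
  have hDm : MeasurableSet[m] D := h0m _ (hDn 0)
  have hDi := integrable_indicator_one (P := P) hDm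
  set q : Ω → ℝ := condProb P ((⨅ n, X n) ⊔ Y) D with hq
  have hqi : Integrable q P := integrable_condExp
  have hqm : StronglyMeasurable[(⨅ n, X n) ⊔ Y] q := stronglyMeasurable_condExp
  have hDsm : ∀ n, StronglyMeasurable[X n ⊔ Y] (D.indicator (fun _ => (1 : ℝ))) := fun n =>
    stronglyMeasurable_const.indicator (hDn n)
  have hae : D.indicator (fun _ => (1 : ℝ)) =ᵐ[P] q := by
    have hset : ∀ s, MeasurableSet[X 0 ⊔ Y] s →
        ∫ ω in s, q ω ∂P = ∫ ω in s, D.indicator (fun _ => (1 : ℝ)) ω ∂P := by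
      intro s hs
      refine setIntegral_sup_eq hqi hDi (hXm 0) hYm (fun a b ha hb => ?_) hs
      have hbm := hYm _ hb
      have hgi : Integrable (b.indicator (q - D.indicator (fun _ => (1 : ℝ)))) P :=
        (hqi.sub hDi).indicator hbm
      have hI : P[b.indicator (q - D.indicator (fun _ => (1 : ℝ))) | ⨅ n, X n] =ᵐ[P] 0 := by
        refine (ae_eq_condExp_of_forall_setIntegral_eq hIm hgi
          (fun s _ _ => (integrable_zero Ω ℝ P).integrableOn) (fun t ht _ => ?_)
          stronglyMeasurable_zero.aestronglyMeasurable).symm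
        have htb : MeasurableSet[(⨅ n, X n) ⊔ Y] (t ∩ b) :=
          ((le_sup_left : _ ≤ (⨅ n, X n) ⊔ Y) _ ht).inter
            ((le_sup_right : Y ≤ (⨅ n, X n) ⊔ Y) _ hb)
        rw [setIntegral_indicator hbm, integral_sub' hqi.integrableOn hDi.integrableOn, hq,
          condProb, setIntegral_condExp hVm hDi htb]
        simp
      have hX0 := condExp_ae_eq_zero_of_condIndepPair hYm hXm hXc (fun i j hij => hanti i j hij)
        hCI hgi (fun n => ((hqm.mono (hVle n)).sub (hDsm n)).indicator
          ((le_sup_right : Y ≤ X n ⊔ Y) _ hb)) hI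
      have hzero := setIntegral_condExp (hXm 0) hgi ha
      rw [integral_congr_ae (ae_restrict_of_ae hX0), setIntegral_indicator hbm,
        integral_sub' hqi.integrableOn hDi.integrableOn] at hzero
      simp only [Pi.zero_apply, integral_zero] at hzero
      linarith
    have h1 := ae_eq_condExp_of_forall_setIntegral_eq h0m hDi
      (fun s _ _ => hqi.integrableOn) (fun s hs _ => hset s hs)
      (hqm.mono (hVle 0)).aestronglyMeasurable
    rw [condExp_of_stronglyMeasurable h0m (hDsm 0) hDi] at h1
    exact h1.symm
  refine measurableSet_of_ae_eq_of_zeroLambda_le hVm (hYc.trans le_sup_right) hDm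
    (hqm.measurable (measurableSet_singleton (1 : ℝ))) ?_
  filter_upwards [hae] with ω hω
  apply propext
  change ω ∈ D ↔ q ω = 1
  rw [← hω]
  by_cases h : ω ∈ D <;> simp [h]
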